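/- arXiv:2009.12345 — 9 statements merged into one kernel-verified Lean document; each statement's English description precedes it below -/
import Mathlib

section
/- Let X = ∏_{i=1}^n X_i where X_i = (a_i, b_i) with 0 < a_i < b_i, and let c_i > 0 and d_{ik} > 0 for all i, k ∈ {1, …, n}. Define f : ℝ_{>0}^n → ℝ^n by f_i(x) = c_i − Σ_{k=1}^n d_{ik} / x_k. If f maps the closure of X into X (i.e., f(x) ∈ X for every x in the closure of X), then f has exactly one fixed point in X. -/
open Set in
/-- A monotone self-map of an order interval in a conditionally complete lattice has a
fixed point. -/
theorem MonotoneOn.exists_fixedPoint_mem_Icc {α : Type*} [ConditionallyCompleteLattice α]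
    {a b : α} (hab : a ≤ b) {f : α → α} (hf : MonotoneOn f (Icc a b))
    (hmaps : MapsTo f (Icc a b) (Icc a b)) : ∃ x ∈ Icc a b, f x = x := by
  set S : Set α := {x | x ∈ Icc a b ∧ x ≤ f x}
  have ha : a ∈ Icc a b := left_mem_Icc.2 hab
  have haS : a ∈ S := ⟨ha, (hmaps ha).1⟩
  have hbdd : BddAbove S := ⟨b, fun x hx => hx.1.2⟩
  have hs : sSup S ∈ Icc a b := ⟨le_csSup hbdd haS, csSup_le ⟨a, haS⟩ fun x hx => hx.1.2⟩
  have hle : sSup S ≤ f (sSup S) :=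
    csSup_le ⟨a, haS⟩ fun x hx => hx.2.trans (hf hx.1 hs (le_csSup hbdd hx))
  exact ⟨sSup S, hs,
    le_antisymm (le_csSup hbdd ⟨hmaps hs, hf hs (hmaps hs) hle⟩) hle⟩

/-- Convexity of `x ↦ d / x` on the positive reals. -/
theorem div_convex_combination_le {d u v t : ℝ} (hd : 0 ≤ d) (hu : 0 < u) (hv : 0 < v)
    (ht₀ : 0 ≤ t) (ht₁ : t ≤ 1) :
    d / ((1 - t) * u + t * v) ≤ (1 - t) * (d / u) + t * (d / v) := by
  have h := (convexOn_zpow (𝕜 := ℝ) (-1)).2 (Set.mem_Ioi.2 hu) (Set.mem_Ioi.2 hv)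
    (sub_nonneg.2 ht₁) ht₀ (by ring)
  simp only [smul_eq_mul, zpow_neg_one] at h
  calc d / ((1 - t) * u + t * v) = d * ((1 - t) * u + t * v)⁻¹ := div_eq_mul_inv _ _
    _ ≤ d * ((1 - t) * u⁻¹ + t * v⁻¹) := mul_le_mul_of_nonneg_left h hd
    _ = _ := by ring

/-- Two fixed points of `x ↦ c - ∑ k, d k / x k` strictly above a point `a` which the map
strictly increases are comparable. -/
theorem le_of_fixedPoint_sub_sum_div {ι : Type*} [Fintype ι] {a c x y : ι → ℝ}
    {d : ι → ι → ℝ} (ha : ∀ i, 0 < a i) (hd : ∀ i k, 0 ≤ d i k)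
    (hfa : ∀ i, a i < c i - ∑ k, d i k / a k)
    (hax : ∀ i, a i < x i) (hay : ∀ i, a i < y i)
    (hx : ∀ i, c i - ∑ k, d i k / x k = x i) (hy : ∀ i, c i - ∑ k, d i k / y k = y i) :
    x ≤ y := by
  intro j
  have : Nonempty ι := ⟨j⟩
  obtain ⟨i, hi⟩ := Finite.exists_min fun i => (y i - a i) / (x i - a i)
  set t := (y i - a i) / (x i - a i)
  have hpos : ∀ k, 0 < x k - a k := fun k => sub_pos.2 (hax k)
  have hmin : ∀ k, t * (x k - a k) ≤ y k - a k := fun k => (le_div_iff₀ (hpos k)).1 (hi k)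
  have ht₀ : 0 ≤ t := div_nonneg (sub_pos.2 (hay i)).le (hpos i).le
  have hti : t * (x i - a i) = y i - a i := div_mul_cancel₀ _ (hpos i).ne'
  rcases le_or_gt 1 t with h1 | h1
  · nlinarith [hmin j, hpos j]
  · exfalso
    have hsum : ∑ k, d i k / y k ≤
        (1 - t) * ∑ k, d i k / a k + t * ∑ k, d i k / x k := by
      rw [Finset.mul_sum, Finset.mul_sum, ← Finset.sum_add_distrib]
      refine Finset.sum_le_sum fun k _ => ?_
      have hz : 0 < (1 - t) * a k + t * x k := by nlinarith [ha k, mul_nonneg ht₀ (hpos k).le]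
      exact (div_le_div_of_nonneg_left (hd i k) hz (by linarith [hmin k])).trans
        (div_convex_combination_le (hd i k) (ha k) ((ha k).trans (hax k)) ht₀ h1.le)
    have h2 := mul_lt_mul_of_pos_left (hfa i) (sub_pos.2 h1)
    have h3 := congrArg (t * ·) (hx i)
    linarith [hy i]

/-- Lemma 3 in the paper (`thm:uniquelem`): for the map
`f_i(x) = c_i - ∑_k d_{ik} / x_k` with positive parameters, if `f` maps the
closure of the open box `X = ∏ (a_i, b_i)` into `X`, then `f` has exactly one
fixed point in `X`. -/
theorem unique_fixed_point_in_box
    (n : ℕ) (a b : Fin n → ℝ) (c : Fin n → ℝ) (d : Fin n → Fin n → ℝ)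
    (ha : ∀ i, 0 < a i) (hab : ∀ i, a i < b i)
    (hc : ∀ i, 0 < c i) (hd : ∀ i k, 0 < d i k)
    (f : (Fin n → ℝ) → (Fin n → ℝ))
    (hf : ∀ x, f x = fun i => c i - ∑ k, d i k / x k)
    (X : Set (Fin n → ℝ))
    (hX : X = Set.univ.pi fun i => Set.Ioo (a i) (b i))
    (hmaps : ∀ x ∈ closure X, f x ∈ X) :
    ∃! x, x ∈ X ∧ f x = x := by
  have hcl : closure X = Set.Icc a b := by
    rw [hX, closure_pi_set, ← Set.pi_univ_Icc]
    exact congrArg _ (funext fun i => closure_Ioo (hab i).ne)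
  have hle : a ≤ b := fun i => (hab i).le
  rw [hcl] at hmaps
  have hXI : X ⊆ Set.Icc a b := hcl ▸ subset_closure
  have hmono : MonotoneOn f (Set.Icc a b) := by
    intro x hx y hy hxy i
    simp only [hf]
    refine sub_le_sub_left (Finset.sum_le_sum fun k _ => ?_) _
    exact div_le_div_of_nonneg_left (hd i k).le ((ha k).trans_le (hx.1 k)) (hxy k)
  obtain ⟨x, hx, hfx⟩ := hmono.exists_fixedPoint_mem_Icc hle fun x hx => hXI (hmaps x hx)
  have hlt : ∀ z ∈ X, ∀ i, a i < z i := fun z hz i => by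
    rw [hX] at hz
    exact (hz i (Set.mem_univ i)).1
  have hfa : ∀ i, a i < c i - ∑ k, d i k / a k := by
    simpa only [hf] using hlt _ (hmaps a (Set.left_mem_Icc.2 hle))
  have hcomp : ∀ u v, u ∈ X ∧ f u = u → v ∈ X ∧ f v = v → u ≤ v := by
    intro u v ⟨hu, hfu⟩ ⟨hv, hfv⟩
    rw [hf] at hfu hfv
    exact le_of_fixedPoint_sub_sum_div ha (fun i k => (hd i k).le) hfa (hlt u hu) (hlt v hv)
      (congrFun hfu) (congrFun hfv)
  have hxX : x ∈ X ∧ f x = x := ⟨hfx ▸ hmaps x hx, hfx⟩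
  exact ⟨x, hxX, fun y hy => le_antisymm (hcomp y x hy hxX) (hcomp x y hxX hy)⟩
end

section
/- Let n ≥ 1, let B̃ be a real n×n matrix, let b_s, V_0 ∈ ℝ^n have all entries strictly positive, and let h ∈ ℝ^n. Suppose (V, u) ∈ ℝ^n × ℝ^n satisfies B̃ V + diag(b_s) u = h, u_i ≥ 0, V_i ≥ 0, and u_i · V_i ≥ V_{0,i}² for all i. Then the vector r defined by r_i = √(V_i / u_i) has all entries strictly positive and belongs to the set P. -/
/-- In the proof of Lemma 4 (`thm:connectd`): if `(V, u)` satisfies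
`B̃ V + [b_s] u = h`, `u ≥ 0`, `V ≥ 0`, and `uᵢ Vᵢ ≥ V₀ᵢ²`, then
`r` with `rᵢ = √(Vᵢ / uᵢ)` is entrywise positive and lies in the set `P`. -/
theorem sqrt_ratio_mem_P
    (n : ℕ) (hn : 1 ≤ n)
    (Btil : Matrix (Fin n) (Fin n) ℝ) (bs V0 h : Fin n → ℝ)
    (hbs : ∀ i, 0 < bs i) (hV0 : ∀ i, 0 < V0 i)
    (P : Set (Fin n → ℝ))
    (hP : P = {r : Fin n → ℝ | (∀ i, 0 < r i) ∧
      ∃ V : Fin n → ℝ,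
        (Btil + Matrix.diagonal fun i => bs i / (r i) ^ 2).mulVec V = h ∧
        ∀ i, r i * V0 i ≤ V i})
    (V u : Fin n → ℝ)
    (heq : Btil.mulVec V + (Matrix.diagonal bs).mulVec u = h)
    (hu : ∀ i, 0 ≤ u i) (hV : ∀ i, 0 ≤ V i)
    (hcone : ∀ i, (V0 i) ^ 2 ≤ u i * V i)
    (r : Fin n → ℝ) (hr : ∀ i, r i = Real.sqrt (V i / u i)) :
    (∀ i, 0 < r i) ∧ r ∈ P := by
  have hprod : ∀ i, 0 < u i * V i := fun i => (pow_pos (hV0 i) 2).trans_le (hcone i)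
  have hu' : ∀ i, 0 < u i := fun i => pos_of_mul_pos_left (hprod i) (hV i)
  have hV' : ∀ i, 0 < V i := fun i => pos_of_mul_pos_right (hprod i) (hu i)
  have hrsq : ∀ i, r i ^ 2 = V i / u i := fun i => by
    rw [hr i, Real.sq_sqrt (div_pos (hV' i) (hu' i)).le]
  have hrpos : ∀ i, 0 < r i := fun i => by
    rw [hr i]
    exact Real.sqrt_pos.mpr (div_pos (hV' i) (hu' i))
  refine ⟨hrpos, ?_⟩
  rw [hP]
  refine ⟨hrpos, V, ?_, fun i => ?_⟩
  · rw [Matrix.add_mulVec, ← heq]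
    congr 1
    ext i
    have hVi := (hV' i).ne'
    have hui := (hu' i).ne'
    rw [Matrix.mulVec_diagonal, Matrix.mulVec_diagonal, hrsq i]
    field_simp
  · refine abs_le_of_sq_le_sq' ?_ (hV i) |>.2
    rw [mul_pow, hrsq i, div_mul_eq_mul_div, div_le_iff₀ (hu' i)]
    calc V i * V0 i ^ 2 ≤ V i * (u i * V i) := mul_le_mul_of_nonneg_left (hcone i) (hV i)
      _ = V i ^ 2 * u i := by ring
end

section
/- Let n ≥ 1, let B̃ be a real n×n matrix, let b_s, V_0 ∈ ℝ^n have all entries strictly positive, and let h ∈ ℝ^n. Then the set P is path-connected: for any s, t ∈ P there exists a continuous map g : [0,1] → ℝ^n with g(0) = s, g(1) = t, and g(λ) ∈ P for all λ ∈ [0,1]. -/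
theorem le_add_mul_add_of_le_mul {a b c x y u v : ℝ} (ha : 0 ≤ a) (hb : 0 ≤ b) (hab : a + b = 1)
    (hc : 0 ≤ c) (hx : 0 < x) (hy : 0 < y) (hu : 0 < u) (hv : 0 < v)
    (hxu : c ≤ x * u) (hyv : c ≤ y * v) :
    c ≤ (a * x + b * y) * (a * u + b * v) := by
  have hcross : 2 * c ≤ x * v + y * u := by
    refine le_of_sq_le_sq ?_ (by positivity)
    nlinarith [sq_nonneg (x * v - y * u), mul_le_mul hxu hyv hc (by positivity)]
  calc c = a ^ 2 * c + b ^ 2 * c + a * b * (2 * c) := by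
        linear_combination (-(c * (a + b + 1))) * hab
    _ ≤ a ^ 2 * (x * u) + b ^ 2 * (y * v) + a * b * (x * v + y * u) := by gcongr
    _ = (a * x + b * y) * (a * u + b * v) := by ring

/-- Voltages `V` for which the radii `r i = √(bs i * V i / (h - Btil *ᵥ V) i)` are well defined,
positive, and satisfy `r i * V0 i ≤ V i`. -/
def admissibleVoltages {ι : Type*} [Fintype ι] (Btil : Matrix ι ι ℝ) (bs V0 h : ι → ℝ) :
    Set (ι → ℝ) :=
  {V | ∀ i, 0 < V i ∧ 0 < (h - Btil.mulVec V) i ∧ bs i * V0 i ^ 2 ≤ V i * (h - Btil.mulVec V) i}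

theorem convex_admissibleVoltages {ι : Type*} [Fintype ι] (Btil : Matrix ι ι ℝ)
    (bs V0 h : ι → ℝ) (hbs : ∀ i, 0 < bs i) :
    Convex ℝ (admissibleVoltages Btil bs V0 h) := by
  intro V hV W hW a b ha hb hab i
  obtain ⟨hV₁, hV₂, hV₃⟩ := hV i
  obtain ⟨hW₁, hW₂, hW₃⟩ := hW i
  have hcomb : (h - Btil.mulVec (a • V + b • W)) i =
      a * (h - Btil.mulVec V) i + b * (h - Btil.mulVec W) i := by
    simp only [Matrix.mulVec_add, Matrix.mulVec_smul, Pi.sub_apply, Pi.add_apply, Pi.smul_apply,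
      smul_eq_mul]
    linear_combination (-(h i)) * hab
  have hpos : ∀ {x y : ℝ}, 0 < x → 0 < y → 0 < a * x + b * y := fun hx hy =>
    convex_Ioi (0 : ℝ) hx hy ha hb hab
  rw [hcomb]
  have hc : 0 ≤ bs i * V0 i ^ 2 := mul_nonneg (hbs i).le (sq_nonneg _)
  exact ⟨hpos hV₁ hW₁, hpos hV₂ hW₂,
    le_add_mul_add_of_le_mul ha hb hab hc hV₁ hW₁ hV₂ hW₂ hV₃ hW₃⟩

theorem mulVec_add_diagonal_eq_iff {ι : Type*} [Fintype ι] [DecidableEq ι] (Btil : Matrix ι ι ℝ)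
    (d V h : ι → ℝ) :
    (Btil + Matrix.diagonal d).mulVec V = h ↔ ∀ i, (h - Btil.mulVec V) i = d i * V i := by
  rw [funext_iff]
  refine forall_congr' fun i => ?_
  rw [Matrix.add_mulVec, Pi.add_apply, Matrix.mulVec_diagonal, Pi.sub_apply, sub_eq_iff_eq_add',
    eq_comm]

/-- Radii are feasible exactly when they come from admissible voltages. -/
theorem feasible_iff_exists_admissibleVoltages {ι : Type*} [Fintype ι] [DecidableEq ι]
    (Btil : Matrix ι ι ℝ) (bs V0 h : ι → ℝ) (hbs : ∀ i, 0 < bs i) (hV0 : ∀ i, 0 < V0 i)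
    (r : ι → ℝ) :
    ((∀ i, 0 < r i) ∧ ∃ V : ι → ℝ,
      (Btil + Matrix.diagonal fun i => bs i / (r i) ^ 2).mulVec V = h ∧
        ∀ i, r i * V0 i ≤ V i) ↔
    ∃ V ∈ admissibleVoltages Btil bs V0 h,
      (fun i => √(bs i * V i / (h - Btil.mulVec V) i)) = r := by
  simp only [mulVec_add_diagonal_eq_iff]
  constructor
  · rintro ⟨hr, V, hV, hle⟩
    have hVpos : ∀ i, 0 < V i := fun i => (mul_pos (hr i) (hV0 i)).trans_le (hle i)
    refine ⟨V, fun i => ⟨hVpos i, ?_, ?_⟩, funext fun i => ?_⟩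
    · have := hr i
      have := hbs i
      have := hVpos i
      rw [hV i]
      positivity
    · have hsq : (r i * V0 i) ^ 2 ≤ V i ^ 2 :=
        pow_le_pow_left₀ (mul_pos (hr i) (hV0 i)).le (hle i) 2
      have hr2 : 0 < r i ^ 2 := pow_pos (hr i) 2
      rw [hV i, show V i * (bs i / r i ^ 2 * V i) = bs i * (V i ^ 2 / r i ^ 2) by ring]
      refine mul_le_mul_of_nonneg_left ?_ (hbs i).le
      rw [le_div_iff₀ hr2]
      linarith [mul_pow (r i) (V0 i) 2]
    · have hV' := (hVpos i).ne'
      have hb := (hbs i).ne'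
      have hr' := (hr i).ne'
      rw [hV i, show bs i * V i / (bs i / r i ^ 2 * V i) = r i ^ 2 by field_simp]
      exact Real.sqrt_sq (hr i).le
  · rintro ⟨V, hV, rfl⟩
    have hq : ∀ i, 0 < bs i * V i / (h - Btil.mulVec V) i := fun i =>
      div_pos (mul_pos (hbs i) (hV i).1) (hV i).2.1
    refine ⟨fun i => Real.sqrt_pos.2 (hq i), V, fun i => ?_, fun i => ?_⟩
    · have hV' := (hV i).1.ne'
      have hw := (hV i).2.1.ne'
      have hb := (hbs i).ne'
      rw [Real.sq_sqrt (hq i).le]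
      field_simp
    · obtain ⟨hV₁, hw, hle⟩ := hV i
      refine le_of_sq_le_sq ?_ hV₁.le
      rw [mul_pow, Real.sq_sqrt (hq i).le, div_mul_eq_mul_div, div_le_iff₀ hw]
      nlinarith [mul_le_mul_of_nonneg_left hle hV₁.le]


/-- Lemma 4 (`thm:connectd`): the set `P` is path-connected. -/
theorem P_path_connected
    (n : ℕ) (hn : 1 ≤ n)
    (Btil : Matrix (Fin n) (Fin n) ℝ) (bs V0 h : Fin n → ℝ)
    (hbs : ∀ i, 0 < bs i) (hV0 : ∀ i, 0 < V0 i)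
    (P : Set (Fin n → ℝ))
    (hP : P = {r : Fin n → ℝ | (∀ i, 0 < r i) ∧
      ∃ V : Fin n → ℝ,
        (Btil + Matrix.diagonal fun i => bs i / (r i) ^ 2).mulVec V = h ∧
        ∀ i, r i * V0 i ≤ V i}) :
    ∀ s ∈ P, ∀ t ∈ P, ∃ g : ℝ → (Fin n → ℝ),
      ContinuousOn g (Set.Icc (0 : ℝ) 1) ∧ g 0 = s ∧ g 1 = t ∧
      ∀ l ∈ Set.Icc (0 : ℝ) 1, g l ∈ P := by
  subst hP
  intro s hs t ht
  obtain ⟨V, hV, rfl⟩ :=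
    (feasible_iff_exists_admissibleVoltages Btil bs V0 h hbs hV0 s).1 hs
  obtain ⟨W, hW, rfl⟩ :=
    (feasible_iff_exists_admissibleVoltages Btil bs V0 h hbs hV0 t).1 ht
  have hmem : ∀ l ∈ Set.Icc (0 : ℝ) 1,
      AffineMap.lineMap V W l ∈ admissibleVoltages Btil bs V0 h := fun l hl =>
    (convex_admissibleVoltages Btil bs V0 h hbs).lineMap_mem hV hW hl
  refine ⟨fun l i => √(bs i * (AffineMap.lineMap V W l : Fin n → ℝ) i /
    (h - Btil.mulVec (AffineMap.lineMap V W l)) i), ?_, by simp, by simp, fun l hl => ?_⟩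
  · have hline : Continuous fun l : ℝ => (AffineMap.lineMap V W l : Fin n → ℝ) :=
      AffineMap.lineMap_continuous
    refine continuousOn_pi.2 fun i => ContinuousOn.sqrt (ContinuousOn.div ?_ ?_ ?_)
    · exact (continuous_const.mul ((continuous_apply i).comp hline)).continuousOn
    · exact ((continuous_apply i).comp
        (continuous_const.sub (continuous_const.matrix_mulVec hline))).continuousOn
    · exact fun l hl => (hmem l hl i).2.1.ne'
  · exact (feasible_iff_exists_admissibleVoltages Btil bs V0 h hbs hV0 _).2
      ⟨_, hmem l hl, rfl⟩
end

section
/- Let n ≥ 1, let B̃ be a real n×n matrix, let b_s, V_0 ∈ ℝ^n have all entries strictly positive, and let h ∈ ℝ^n. For every r ∈ ℝ^n with all entries strictly positive, the following are equivalent, where V denotes the vector with V_i = r_i V_{0,i}: (i) B_LL(r) V = h; (ii) V_i · ((B̃ V)_i − h_i) = −Q*_i for every i, where Q*_i = V_{0,i}² b_{s,i}. -/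
/-- Proposition 1 of the paper: `r > 0` is an equilibrium of the LTC dynamics,
i.e. `B_LL(r) ([r] V₀) = h`, if and only if `V = [r] V₀` solves the power flow
equations `[V] (B̃ V - h) = -Q*` with `Q*ᵢ = V₀ᵢ² b_{s,i}`. -/
theorem equilibrium_iff_power_flow
    (n : ℕ) (hn : 1 ≤ n)
    (Btil : Matrix (Fin n) (Fin n) ℝ) (bs V0 h : Fin n → ℝ)
    (hbs : ∀ i, 0 < bs i) (hV0 : ∀ i, 0 < V0 i)
    (r : Fin n → ℝ) (hr : ∀ i, 0 < r i)
    (V : Fin n → ℝ) (hV : ∀ i, V i = r i * V0 i) :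
    (Btil + Matrix.diagonal fun i => bs i / (r i) ^ 2).mulVec V = h ↔
      ∀ i, V i * (Btil.mulVec V i - h i) = -((V0 i) ^ 2 * bs i) := by
  rw [funext_iff]
  refine forall_congr' fun i => ?_
  have hr0 : r i ≠ 0 := (hr i).ne'
  have hVi : V i ≠ 0 := by
    rw [hV i]
    exact mul_ne_zero hr0 (hV0 i).ne'
  have hload : V i * (bs i / r i ^ 2 * V i) = V0 i ^ 2 * bs i := by
    rw [hV i]
    field_simp
  rw [Matrix.add_mulVec, Pi.add_apply, Matrix.mulVec_diagonal, ← mul_right_inj' hVi]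
  constructor <;> intro heq <;> linarith
end

section
/- Let n ≥ 1, let Z be a real n×n matrix with all entries strictly positive, let V_0, b ∈ ℝ^n have all entries strictly positive, and let E ∈ ℝ^n. Define f : ℝ_{>0}^n → ℝ^n by f_i(x) = (1/V_{0,i}) (E_i − Σ_{k=1}^n Z_{ik} V_{0,k} b_k / x_k). Suppose r̲ ∈ ℝ^n has all entries strictly positive and r̲_i < f_i(r̲) for every i. Then for any r̄ ∈ ℝ^n with r̄_i ≥ E_i / V_{0,i} for all i, f maps the closed box ∏_{i=1}^n [r̲_i, r̄_i] into the open box ∏_{i=1}^n (r̲_i, r̄_i): for every x with r̲ ≤ x ≤ r̄ componentwise, r̲_i < f_i(x) < r̄_i for every i. -/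
/-- The self-mapping property in the proof of Lemma 1 (`thm:uniqueeq`): if
`r̲ > 0` satisfies `r̲ᵢ < f_i(r̲)` for all `i`, then for any `r̄` with
`r̄ᵢ ≥ Eᵢ/V₀ᵢ`, the map `f` sends the closed box `[r̲, r̄]` into the open box
`(r̲, r̄)`. -/
theorem fixed_point_map_maps_box
    (n : ℕ) (hn : 1 ≤ n)
    (Z : Matrix (Fin n) (Fin n) ℝ) (hZ : ∀ i k, 0 < Z i k)
    (V0 b : Fin n → ℝ) (hV0 : ∀ i, 0 < V0 i) (hb : ∀ i, 0 < b i)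
    (E : Fin n → ℝ)
    (f : (Fin n → ℝ) → (Fin n → ℝ))
    (hf : ∀ x, f x = fun i => (1 / V0 i) * (E i - ∑ k, Z i k * V0 k * b k / x k))
    (rlo : Fin n → ℝ) (hrlo : ∀ i, 0 < rlo i) (hlt : ∀ i, rlo i < f rlo i)
    (rhi : Fin n → ℝ) (hrhi : ∀ i, E i / V0 i ≤ rhi i) :
    ∀ x : Fin n → ℝ, (∀ i, rlo i ≤ x i) → (∀ i, x i ≤ rhi i) →
      ∀ i, rlo i < f x i ∧ f x i < rhi i := by
  intro x hlo _ i
  have hnum : ∀ k, 0 < Z i k * V0 k * b k := fun k =>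
    mul_pos (mul_pos (hZ i k) (hV0 k)) (hb k)
  have hx : ∀ k, 0 < x k := fun k => (hrlo k).trans_le (hlo k)
  have hinv : 0 < 1 / V0 i := one_div_pos.mpr (hV0 i)
  constructor
  · refine (hlt i).trans_le ?_
    simp only [hf]
    refine mul_le_mul_of_nonneg_left (sub_le_sub_left (Finset.sum_le_sum fun k _ => ?_) _) hinv.le
    exact div_le_div_of_nonneg_left (hnum k).le (hrlo k) (hlo k)
  · refine lt_of_lt_of_le ?_ (hrhi i)
    have hsum : 0 < ∑ k, Z i k * V0 k * b k / x k :=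
      Finset.sum_pos (fun k _ => div_pos (hnum k) (hx k)) ⟨i, Finset.mem_univ i⟩
    simp only [hf]
    rw [div_eq_inv_mul (E i), ← one_div]
    exact mul_lt_mul_of_pos_left (sub_lt_self _ hsum) hinv
end

section
/- Let n ≥ 1, let Z be a real n×n matrix with all entries strictly positive, let V_0, b ∈ ℝ^n have all entries strictly positive, and let E ∈ ℝ^n. Define f : ℝ_{>0}^n → ℝ^n by f_i(x) = (1/V_{0,i}) (E_i − Σ_{k=1}^n Z_{ik} V_{0,k} b_k / x_k). Suppose r̲ ∈ ℝ^n has all entries strictly positive and r̲_i < f_i(r̲) for every i. Then f has exactly one fixed point in the set A(r̲) = {x ∈ ℝ^n : x_i ≥ r̲_i for all i}. -/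
/-- A map that is monotone and bounded above on `{x | r ≤ x}` and satisfies `r ≤ g r` has a fixed
point there. -/
lemma exists_fixed_point_of_monotoneOn {ι : Type*} {g : (ι → ℝ) → ι → ℝ} {r u : ι → ℝ}
    (hmono : MonotoneOn g (Set.Ici r)) (hr : r ≤ g r) (hu : ∀ x, r ≤ x → g x ≤ u) :
    ∃ x, r ≤ x ∧ g x = x := by
  let S : Set (ι → ℝ) := {x | r ≤ x ∧ x ≤ g x}
  let s : ι → ℝ := fun i => ⨆ x : S, x.1 i
  have hle : ∀ x ∈ S, x ≤ s := fun x hx i =>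
    le_ciSup (f := fun x : S => x.1 i)
      ⟨u i, by rintro _ ⟨y, rfl⟩; exact (y.2.2 i).trans (hu y.1 y.2.1 i)⟩ ⟨x, hx⟩
  have hrS : r ∈ S := ⟨le_rfl, hr⟩
  have hrs : r ≤ s := hle r hrS
  have : Nonempty S := ⟨⟨r, hrS⟩⟩
  have hs : s ≤ g s := fun i =>
    ciSup_le fun x => (x.2.2 i).trans (hmono x.2.1 hrs (hle x.1 x.2) i)
  have hgs : r ≤ g s := hrs.trans hs
  exact ⟨s, hrs, le_antisymm (hle (g s) ⟨hgs, hmono hrs hgs hs⟩) hs⟩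

/-- If `g` is monotone and concave on `{x | r ≤ x}` with `r < g r` in every coordinate, then any two
fixed points `x`, `y` there satisfy `x ≤ y`. -/
lemma fixed_point_le_of_concave {ι : Type*} [Finite ι] {g : (ι → ℝ) → ι → ℝ} {r x y : ι → ℝ}
    (hmono : MonotoneOn g (Set.Ici r)) (hconc : ∀ i, ConcaveOn ℝ (Set.Ici r) fun z => g z i)
    (hr : ∀ i, r i < g r i) (hx : r ≤ x) (hy : r ≤ y) (hgx : g x = x) (hgy : g y = y) :
    x ≤ y := by
  by_contra hxy
  obtain ⟨j, hj⟩ : ∃ j, y j < x j := by simpa [Pi.le_def] using hxy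
  have : Nonempty ι := ⟨j⟩
  have hrr : r ∈ Set.Ici r := Set.self_mem_Ici
  have hrx : ∀ i, 0 < x i - r i := fun i =>
    sub_pos.2 ((hr i).trans_le ((hmono hrr hx hx i).trans_eq (congrFun hgx i)))
  have hry : ∀ i, 0 < y i - r i := fun i =>
    sub_pos.2 ((hr i).trans_le ((hmono hrr hy hy i).trans_eq (congrFun hgy i)))
  obtain ⟨m, hm⟩ := Finite.exists_min fun i => (y i - r i) / (x i - r i)
  set t := (y m - r m) / (x m - r m) with ht
  have ht0 : 0 < t := div_pos (hry m) (hrx m)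
  have ht1 : t < 1 := (hm j).trans_lt ((div_lt_one (hrx j)).2 (by linarith))
  have hz : r ≤ (1 - t) • r + t • x := fun i => by
    have := mul_pos ht0 (hrx i)
    simp only [Pi.add_apply, Pi.smul_apply, smul_eq_mul]
    linarith
  have hzy : (1 - t) • r + t • x ≤ y := fun i => by
    have := (le_div_iff₀ (hrx i)).1 (hm i)
    simp only [Pi.add_apply, Pi.smul_apply, smul_eq_mul]
    linarith
  have hc := (hconc m).2 hrr hx (sub_nonneg.2 ht1.le) ht0.le (sub_add_cancel 1 t)
  have hmy := hmono hz hy hzy m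
  have htm : t * (x m - r m) = y m - r m := div_mul_cancel₀ _ (hrx m).ne'
  have hlt := mul_lt_mul_of_pos_left (hr m) (sub_pos.2 ht1)
  simp only [smul_eq_mul, hgx, hgy] at hc hmy
  linarith

/-- The uniqueness step in the proof of Lemma 1 (`thm:uniqueeq`): if `r̲ > 0`
satisfies `r̲ᵢ < f_i(r̲)` for all `i`, then `f` has exactly one fixed point in
`A(r̲) = {x : x ≥ r̲}`. -/
theorem unique_fixed_point_above
    (n : ℕ) (hn : 1 ≤ n)
    (Z : Matrix (Fin n) (Fin n) ℝ) (hZ : ∀ i k, 0 < Z i k)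
    (V0 b : Fin n → ℝ) (hV0 : ∀ i, 0 < V0 i) (hb : ∀ i, 0 < b i)
    (E : Fin n → ℝ)
    (f : (Fin n → ℝ) → (Fin n → ℝ))
    (hf : ∀ x, f x = fun i => (1 / V0 i) * (E i - ∑ k, Z i k * V0 k * b k / x k))
    (rlo : Fin n → ℝ) (hrlo : ∀ i, 0 < rlo i) (hlt : ∀ i, rlo i < f rlo i) :
    ∃! x : Fin n → ℝ, (∀ i, rlo i ≤ x i) ∧ f x = x := by
  have hc : ∀ i k, 0 < Z i k * V0 k * b k := fun i k =>
    mul_pos (mul_pos (hZ i k) (hV0 k)) (hb k)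
  have hpos : ∀ x, rlo ≤ x → ∀ k, 0 < x k := fun x hx k => (hrlo k).trans_le (hx k)
  have hmono : MonotoneOn f (Set.Ici rlo) := by
    intro x hx y hy hxy i
    simp only [hf]
    refine mul_le_mul_of_nonneg_left ?_ (one_div_pos.2 (hV0 i)).le
    exact sub_le_sub_left (Finset.sum_le_sum fun k _ =>
      div_le_div_of_nonneg_left (hc i k).le (hpos x hx k) (hxy k)) _
  have hconc : ∀ i, ConcaveOn ℝ (Set.Ici rlo) fun z => f z i := by
    refine fun i => ⟨convex_Ici rlo, fun x hx y hy s t hs ht hst => ?_⟩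
    have hsum : ∑ k, Z i k * V0 k * b k / (s • x + t • y) k ≤
        s * ∑ k, Z i k * V0 k * b k / x k + t * ∑ k, Z i k * V0 k * b k / y k := by
      rw [Finset.mul_sum, Finset.mul_sum, ← Finset.sum_add_distrib]
      refine Finset.sum_le_sum fun k _ => ?_
      have hinv := (convexOn_zpow (𝕜 := ℝ) (-1)).2 (hpos x hx k) (hpos y hy k) hs ht hst
      simp only [zpow_neg_one, smul_eq_mul] at hinv
      have := mul_le_mul_of_nonneg_left hinv (hc i k).le
      simp only [Pi.add_apply, Pi.smul_apply, smul_eq_mul, div_eq_mul_inv]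
      linarith
    have hV := mul_le_mul_of_nonneg_left hsum (one_div_pos.2 (hV0 i)).le
    simp only [hf, smul_eq_mul]
    have hE : 1 / V0 i * E i = s * (1 / V0 i * E i) + t * (1 / V0 i * E i) := by
      rw [← add_mul, hst, one_mul]
    linarith
  have hbdd : ∀ x, rlo ≤ x → f x ≤ fun i => 1 / V0 i * E i := by
    intro x hx i
    simp only [hf]
    refine mul_le_mul_of_nonneg_left ?_ (one_div_pos.2 (hV0 i)).le
    exact sub_le_self _ (Finset.sum_nonneg fun k _ => (div_pos (hc i k) (hpos x hx k)).le)
  obtain ⟨x, hx, hfx⟩ := exists_fixed_point_of_monotoneOn hmono (fun i => (hlt i).le) hbdd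
  exact ⟨x, ⟨hx, hfx⟩, fun y ⟨hy, hfy⟩ => le_antisymm
    (fixed_point_le_of_concave hmono hconc hlt hy hx hfy hfx)
    (fixed_point_le_of_concave hmono hconc hlt hx hy hfx hfy)⟩
end

section
/- Let n ≥ 1, let Z be a real n×n matrix with all entries strictly positive, let V_0, b ∈ ℝ^n have all entries strictly positive, and let E ∈ ℝ^n. Define f : ℝ_{>0}^n → ℝ^n by f_i(x) = (1/V_{0,i}) (E_i − Σ_{k=1}^n Z_{ik} V_{0,k} b_k / x_k). Suppose r̲ ∈ ℝ^n has all entries strictly positive and r̲_i ≤ f_i(r̲) for every i. Then every fixed point x of f with x ≥ r̲ componentwise and x ≠ r̲ satisfies x_i > r̲_i for every i; in particular, no fixed point of f other than possibly r̲ itself lies on the boundary of the set A(r̲) = {x : x ≥ r̲}. -/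
/-- The boundary step in the proof of Lemma 1 (`thm:uniqueeq`): if `r̲ > 0`
satisfies `r̲ᵢ ≤ f_i(r̲)` for all `i`, then every fixed point `x ≥ r̲` of `f`
with `x ≠ r̲` satisfies `xᵢ > r̲ᵢ` for every `i` (so no fixed point other than
possibly `r̲` lies on the boundary of `A(r̲)`). -/
theorem fixed_point_strictly_above
    (n : ℕ) (hn : 1 ≤ n)
    (Z : Matrix (Fin n) (Fin n) ℝ) (hZ : ∀ i k, 0 < Z i k)
    (V0 b : Fin n → ℝ) (hV0 : ∀ i, 0 < V0 i) (hb : ∀ i, 0 < b i)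
    (E : Fin n → ℝ)
    (f : (Fin n → ℝ) → (Fin n → ℝ))
    (hf : ∀ x, f x = fun i => (1 / V0 i) * (E i - ∑ k, Z i k * V0 k * b k / x k))
    (rlo : Fin n → ℝ) (hrlo : ∀ i, 0 < rlo i) (hle : ∀ i, rlo i ≤ f rlo i) :
    ∀ x : Fin n → ℝ, f x = x → (∀ i, rlo i ≤ x i) → x ≠ rlo →
      ∀ i, rlo i < x i := by
  intro x hfx hx hne i
  obtain ⟨j, hj⟩ : ∃ j, rlo j < x j := by
    by_contra! h
    exact hne (funext fun k => le_antisymm (h k) (hx k))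
  have hc : ∀ k, 0 < Z i k * V0 k * b k := fun k =>
    mul_pos (mul_pos (hZ i k) (hV0 k)) (hb k)
  have hsum : ∑ k, Z i k * V0 k * b k / x k < ∑ k, Z i k * V0 k * b k / rlo k :=
    Finset.sum_lt_sum
      (fun k _ => div_le_div_of_nonneg_left (hc k).le (hrlo k) (hx k))
      ⟨j, Finset.mem_univ j, div_lt_div_of_pos_left (hc j) (hrlo j) hj⟩
  calc rlo i ≤ f rlo i := hle i
    _ < f x i := by
      simp only [hf]
      exact mul_lt_mul_of_pos_left (sub_lt_sub_left hsum _) (one_div_pos.mpr (hV0 i))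
    _ = x i := congrFun hfx i
end

section
/- Let n ≥ 1, let B̃ be an invertible real n×n matrix whose inverse Z = B̃^{-1} has all entries strictly positive, let b_s, V_0 ∈ ℝ^n have all entries strictly positive, and let h ∈ ℝ^n. Let M = {x ∈ ℝ_{>0}^n : B_LL(x)([x]V_0) = h} be the equilibrium set and P = {r ∈ ℝ_{>0}^n : ∃ V ∈ ℝ^n, B_LL(r)V = h and V_i ≥ r_i V_{0,i} ∀i}. Assume M is finite and that α ∈ P is the greatest element of P (α ≥ r componentwise for all r ∈ P). Then for every r̲ ∈ P with r̲ ≠ α, the set {x ∈ M : x ≥ r̲ componentwise and x ≠ r̲} has exactly one element. -/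
/-- The map `x ↦ W (h - c / x)`, whose positive fixed points are the equilibria. -/
noncomputable def loadMap {ι : Type*} [Fintype ι] (W : ι → ι → ℝ) (h c x : ι → ℝ) : ι → ℝ :=
  fun i => ∑ k, W i k * (h k - c k / x k)

section LoadMap

variable {ι : Type*} [Fintype ι] {W : ι → ι → ℝ} {h c x y : ι → ℝ}

theorem loadMap_mono (hW : ∀ i k, 0 < W i k) (hc : ∀ k, 0 < c k) (hx : ∀ k, 0 < x k)
    (hxy : x ≤ y) : loadMap W h c x ≤ loadMap W h c y := by
  intro i
  refine Finset.sum_le_sum fun k _ => mul_le_mul_of_nonneg_left ?_ (hW i k).le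
  have := div_le_div_of_nonneg_left (hc k).le (hx k) (hxy k)
  linarith

theorem loadMap_strict_mono (hW : ∀ i k, 0 < W i k) (hc : ∀ k, 0 < c k) (hx : ∀ k, 0 < x k)
    (hxy : x ≤ y) (hne : x ≠ y) (i : ι) : loadMap W h c x i < loadMap W h c y i := by
  obtain ⟨j, hj⟩ := Function.ne_iff.mp hne
  refine Finset.sum_lt_sum (fun k _ => mul_le_mul_of_nonneg_left ?_ (hW i k).le)
    ⟨j, Finset.mem_univ j, mul_lt_mul_of_pos_left ?_ (hW i j)⟩
  · have := div_le_div_of_nonneg_left (hc k).le (hx k) (hxy k)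
    linarith
  · have := div_lt_div_of_pos_left (hc j) (hx j) (lt_of_le_of_ne (hxy j) hj)
    linarith

theorem loadMap_le (hW : ∀ i k, 0 < W i k) (hc : ∀ k, 0 < c k) (hx : ∀ k, 0 < x k) :
    loadMap W h c x ≤ fun i => ∑ k, W i k * h k := by
  intro i
  refine Finset.sum_le_sum fun k _ => mul_le_mul_of_nonneg_left ?_ (hW i k).le
  have := div_pos (hc k) (hx k)
  linarith

/-- Above every positive `x` with `x ≤ loadMap x` there is a fixed point. -/
theorem exists_loadMap_fixed_ge (hW : ∀ i k, 0 < W i k) (hc : ∀ k, 0 < c k) (hx : ∀ k, 0 < x k)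
    (hsub : x ≤ loadMap W h c x) : ∃ y, x ≤ y ∧ loadMap W h c y = y := by
  set S : Set (ι → ℝ) := {y | x ≤ y ∧ y ≤ loadMap W h c y} with hS
  have hpos : ∀ y, x ≤ y → ∀ k, 0 < y k := fun y hy k => (hx k).trans_le (hy k)
  have hbdd : BddAbove S := ⟨_, fun y hy => hy.2.trans (loadMap_le hW hc (hpos y hy.1))⟩
  have hxS : x ∈ S := ⟨le_rfl, hsub⟩
  have hxs : x ≤ sSup S := le_csSup hbdd hxS
  have hle : sSup S ≤ loadMap W h c (sSup S) := csSup_le ⟨x, hxS⟩ fun y hy =>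
    hy.2.trans (loadMap_mono hW hc (hpos y hy.1) (le_csSup hbdd hy))
  refine ⟨sSup S, hxs, le_antisymm (le_csSup hbdd ⟨hxs.trans hle, ?_⟩) hle⟩
  exact loadMap_mono hW hc (hpos _ hxs) hle

theorem sq_div_add_lt_inv_add {a b s : ℝ} (ha : 0 < a) (hab : a < b) (hs : 0 < s) :
    (1 + s) ^ 2 / (a + s * b) < 1 / a + s / b := by
  have hb : 0 < b := ha.trans hab
  have h1 : 0 < a + s * b := by positivity
  rw [div_add_div _ _ ha.ne' hb.ne', div_lt_div_iff₀ h1 (by positivity)]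
  nlinarith [mul_pos hs (pow_pos (sub_pos.2 hab) 2)]

/-- Strict concavity of `loadMap` along an increasing segment, with unnormalised weights. -/
theorem loadMap_strict_concave (hW : ∀ i k, 0 < W i k) (hc : ∀ k, 0 < c k)
    {z : ι → ℝ} {s : ℝ} (hs : 0 < s) (hx : ∀ k, 0 < x k) (hxz : ∀ k, x k < z k)
    (hy : ∀ k, (1 + s) * y k = x k + s * z k) (i : ι) :
    loadMap W h c x i + s * loadMap W h c z i < (1 + s) * loadMap W h c y i := by
  unfold loadMap
  rw [Finset.mul_sum, Finset.mul_sum, ← Finset.sum_add_distrib]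
  refine Finset.sum_lt_sum_of_nonempty ⟨i, Finset.mem_univ i⟩ fun k _ => ?_
  have hs1 : 0 < 1 + s := by linarith
  have hconv := mul_lt_mul_of_pos_left (sq_div_add_lt_inv_add (hx k) (hxz k) hs) (hc k)
  have hyk : c k * ((1 + s) ^ 2 / (x k + s * z k)) = (1 + s) * (c k / y k) := by
    rw [← hy k, pow_two, mul_div_mul_left _ _ hs1.ne']
    ring
  have hexp : c k * (1 / x k + s / z k) = c k / x k + s * (c k / z k) := by ring
  rw [hyk, hexp] at hconv
  have := mul_lt_mul_of_pos_left hconv (hW i k)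
  linarith

/-- A fixed point strictly between a point `x ≤ loadMap x` and another fixed point
cannot exist. -/
theorem loadMap_fixed_eq (hW : ∀ i k, 0 < W i k) (hc : ∀ k, 0 < c k) {r a : ι → ℝ}
    (hr : ∀ k, 0 < r k) (hsub : r ≤ loadMap W h c r) (hrx : r ≤ x) (hxr : x ≠ r)
    (hxa : x ≤ a) (hx : loadMap W h c x = x) (ha : loadMap W h c a = a) : x = a := by
  by_contra hne
  have hxpos : ∀ k, 0 < x k := fun k => (hr k).trans_le (hrx k)
  have hlt_a : ∀ k, x k < a k := fun k => by
    have := loadMap_strict_mono (h := h) hW hc hxpos hxa hne k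
    rwa [hx, ha] at this
  have hr_lt : ∀ k, r k < x k := fun k => by
    have := loadMap_strict_mono (h := h) hW hc hr hrx hxr.symm k
    rw [hx] at this
    exact (hsub k).trans_lt this
  obtain ⟨j₀, -⟩ := Function.ne_iff.mp hne
  have : Nonempty ι := ⟨j₀⟩
  obtain ⟨j, hj⟩ := Finite.exists_min fun k => (x k - r k) / (a k - x k)
  set s := (x j - r j) / (a j - x j)
  have hs : 0 < s := div_pos (sub_pos.2 (hr_lt j)) (sub_pos.2 (hlt_a j))
  set y : ι → ℝ := fun k => x k - s * (a k - x k) with hy_def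
  have hry : r ≤ y := fun k => by
    have := (le_div_iff₀ (sub_pos.2 (hlt_a k))).1 (hj k)
    simp only [hy_def]
    linarith
  have hyj : y j = r j := by
    have : s * (a j - x j) = x j - r j := div_mul_cancel₀ _ (sub_pos.2 (hlt_a j)).ne'
    simp only [hy_def]
    linarith
  have hya : ∀ k, y k < a k := fun k => by
    have := mul_pos hs (sub_pos.2 (hlt_a k))
    have := hlt_a k
    simp only [hy_def]
    linarith
  have hconc := loadMap_strict_concave (h := h) (y := x) hW hc hs
    (fun k => (hr k).trans_le (hry k)) hya (fun k => by simp only [hy_def]; ring) j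
  have hmono := loadMap_mono (h := h) hW hc hr hry j
  have hsubj := hsub j
  rw [hx, ha] at hconc
  have : y j = x j - s * (a j - x j) := rfl
  linarith

end LoadMap

theorem add_diagonal_mulVec_eq_iff {ι : Type*} [Fintype ι] [DecidableEq ι]
    {B : Matrix ι ι ℝ} (hB : IsUnit B.det) (d V h : ι → ℝ) :
    (B + Matrix.diagonal d).mulVec V = h ↔ ∀ i, V i = ∑ k, B⁻¹ i k * (h k - d k * V k) := by
  have key : (B + Matrix.diagonal d).mulVec V = h ↔
      V = B⁻¹.mulVec (fun k => h k - d k * V k) := by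
    have hd : (Matrix.diagonal d).mulVec V = fun k => d k * V k := by
      ext k; exact Matrix.mulVec_diagonal d V k
    rw [Matrix.add_mulVec, hd, ← eq_sub_iff_add_eq]
    constructor
    · intro e
      have e' : B.mulVec V = fun k => h k - d k * V k := e
      rw [← e', Matrix.mulVec_mulVec, Matrix.nonsing_inv_mul _ hB, Matrix.one_mulVec]
    · intro e
      have := congrArg B.mulVec e
      rwa [Matrix.mulVec_mulVec, Matrix.mul_nonsing_inv _ hB, Matrix.one_mulVec] at this
  rw [key, funext_iff]
  rfl

/-- Lemma 1 of the paper (`thm:uniqueeq`): if the equilibrium set `M` is finite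
and `α` is the greatest element of `P`, then for every `r̲ ∈ P` with `r̲ ≠ α`
there is a unique equilibrium in `A(r̲) = {x : x ≥ r̲}` other than possibly
`r̲` itself. -/
theorem unique_equilibrium_above
    (n : ℕ) (hn : 1 ≤ n)
    (Btil : Matrix (Fin n) (Fin n) ℝ) (hdet : IsUnit Btil.det)
    (hZpos : ∀ i k, 0 < Btil⁻¹ i k)
    (bs V0 h : Fin n → ℝ) (hbs : ∀ i, 0 < bs i) (hV0 : ∀ i, 0 < V0 i)
    (M P : Set (Fin n → ℝ))
    (hM : M = {x : Fin n → ℝ | (∀ i, 0 < x i) ∧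
      (Btil + Matrix.diagonal fun i => bs i / (x i) ^ 2).mulVec
        (fun i => x i * V0 i) = h})
    (hP : P = {r : Fin n → ℝ | (∀ i, 0 < r i) ∧
      ∃ V : Fin n → ℝ,
        (Btil + Matrix.diagonal fun i => bs i / (r i) ^ 2).mulVec V = h ∧
        ∀ i, r i * V0 i ≤ V i})
    (hMfin : M.Finite)
    (α : Fin n → ℝ) (hα : α ∈ P) (hmax : ∀ r ∈ P, ∀ i, r i ≤ α i) :
    ∀ rlo ∈ P, rlo ≠ α →
      ∃! x : Fin n → ℝ, x ∈ M ∧ (∀ i, rlo i ≤ x i) ∧ x ≠ rlo := by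
  subst hM hP
  set W : Fin n → Fin n → ℝ := fun i k => Btil⁻¹ i k / V0 i with hW_def
  set c : Fin n → ℝ := fun k => bs k * V0 k with hc_def
  have hW : ∀ i k, 0 < W i k := fun i k => div_pos (hZpos i k) (hV0 i)
  have hc : ∀ k, 0 < c k := fun k => mul_pos (hbs k) (hV0 k)
  have hload : ∀ x i, loadMap W h c x i * V0 i = ∑ k, Btil⁻¹ i k * (h k - c k / x k) := by
    intro x i
    rw [loadMap, Finset.sum_mul]
    refine Finset.sum_congr rfl fun k _ => ?_
    have := (hV0 i).ne'
    simp only [hW_def]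
    field_simp
  have hcoef : ∀ x : Fin n → ℝ, (∀ i, 0 < x i) → ∀ k,
      bs k / x k ^ 2 * (x k * V0 k) = c k / x k := by
    intro x hx k
    have := (hx k).ne'
    simp only [hc_def]
    field_simp
  have hequil : ∀ x : Fin n → ℝ, (∀ i, 0 < x i) →
      ((Btil + Matrix.diagonal fun i => bs i / (x i) ^ 2).mulVec (fun i => x i * V0 i) = h ↔
        loadMap W h c x = x) := by
    intro x hx
    rw [add_diagonal_mulVec_eq_iff hdet, funext_iff]
    simp only [hcoef x hx, ← hload]
    exact forall_congr' fun i => ⟨fun e => (mul_right_cancel₀ (hV0 i).ne' e).symm,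
      fun e => by rw [e]⟩
  have hsub : ∀ r : Fin n → ℝ, (∀ i, 0 < r i) → (∃ V : Fin n → ℝ,
      (Btil + Matrix.diagonal fun i => bs i / (r i) ^ 2).mulVec V = h ∧
        ∀ i, r i * V0 i ≤ V i) → r ≤ loadMap W h c r := by
    rintro r hr ⟨V, hV, hle⟩ i
    rw [add_diagonal_mulVec_eq_iff hdet] at hV
    refine le_of_mul_le_mul_right ((hle i).trans ?_) (hV0 i)
    rw [hV i, hload]
    refine Finset.sum_le_sum fun k _ => mul_le_mul_of_nonneg_left ?_ (hZpos i k).le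
    have := mul_le_mul_of_nonneg_left (hle k) (div_pos (hbs k) (pow_pos (hr k) 2)).le
    rw [hcoef r hr] at this
    linarith
  have hfixP : ∀ x : Fin n → ℝ, (∀ i, 0 < x i) → loadMap W h c x = x → x ≤ α :=
    fun x hx e => hmax x ⟨hx, _, (hequil x hx).2 e, fun _ => le_rfl⟩
  obtain ⟨y, hαy, hy⟩ := exists_loadMap_fixed_ge hW hc hα.1 (hsub α hα.1 hα.2)
  have hyα : y = α := le_antisymm (hfixP y (fun k => (hα.1 k).trans_le (hαy k)) hy) hαy
  rw [hyα] at hy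
  intro r hr hne
  refine ⟨α, ⟨⟨hα.1, (hequil α hα.1).2 hy⟩, hmax r hr, hne.symm⟩, ?_⟩
  rintro x ⟨⟨hx, hxe⟩, hrx, hxr⟩
  have hfix := (hequil x hx).1 hxe
  exact loadMap_fixed_eq hW hc hr.1 (hsub r hr.1 hr.2) hrx hxr (hfixP x hx hfix) hfix hy
end

section
/- Let n ≥ 1 and let r_0, V_0 ∈ ℝ^n have all entries strictly positive. Let r ∈ ℝ^n satisfy 0 < r_i ≤ r_{0,i} for all i, let V ∈ ℝ^n, and define u ∈ ℝ^n by u_i = V_i / r_i². Then V_i ≥ r_i V_{0,i} for all i if and only if, for all i, u_i · V_i ≥ V_{0,i}², r_{0,i}² u_i ≥ V_i, and V_i ≥ 0. -/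
/-- Correctness of the change of variables `u = [r]⁻² V` used to reformulate
the stability-certification problem as an SOCP: for `0 < r ≤ r₀` and
`uᵢ = Vᵢ / rᵢ²`, the constraint `Vᵢ ≥ rᵢ V₀ᵢ` for all `i` is equivalent to
`uᵢ Vᵢ ≥ V₀ᵢ²`, `r₀ᵢ² uᵢ ≥ Vᵢ`, and `Vᵢ ≥ 0` for all `i`. -/
theorem change_of_variables_equiv
    (n : ℕ) (hn : 1 ≤ n)
    (r0 V0 : Fin n → ℝ) (hr0 : ∀ i, 0 < r0 i) (hV0 : ∀ i, 0 < V0 i)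
    (r : Fin n → ℝ) (hr : ∀ i, 0 < r i) (hrr0 : ∀ i, r i ≤ r0 i)
    (V : Fin n → ℝ)
    (u : Fin n → ℝ) (hu : ∀ i, u i = V i / (r i) ^ 2) :
    (∀ i, r i * V0 i ≤ V i) ↔
      (∀ i, (V0 i) ^ 2 ≤ u i * V i ∧ V i ≤ (r0 i) ^ 2 * u i ∧ 0 ≤ V i) := by
  refine forall_congr' fun i => ?_
  have hri := hr i
  have hsq : (V0 i) ^ 2 ≤ u i * V i ↔ (r i * V0 i) ^ 2 ≤ V i ^ 2 := by
    rw [hu, div_mul_eq_mul_div, le_div_iff₀ (by positivity), mul_pow, mul_comm, sq (V i)]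
  have hprod : 0 ≤ r i * V0 i := (mul_pos hri (hV0 i)).le
  rw [hsq]
  constructor
  · intro h
    have hV : 0 ≤ V i := hprod.trans h
    refine ⟨pow_le_pow_left₀ hprod h 2, ?_, hV⟩
    rw [hu, mul_div_assoc', le_div_iff₀ (by positivity), mul_comm]
    exact mul_le_mul_of_nonneg_right (pow_le_pow_left₀ hri.le (hrr0 i) 2) hV
  · rintro ⟨h, -, hV⟩
    exact (sq_le_sq₀ hprod hV).mp h
end
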